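/- Let X be a locally compact zero-dimensional space, let S ⊆ Homeo(X) with 1 ∈ S and S = S⁻¹, let G = ⟨S⟩, and let V₀ be a compact open subset of X. For n ∈ ℕ let V_n = ⋂_{g ∈ Sⁿ} g(V₀), V_∞ = ⋂_{g ∈ G} g(V₀), and P_n = (⋃_{g ∈ Sⁿ} g(V_n)) \ V₁. Suppose that P_n is compact and V_n is open for all sufficiently large n ∈ ℕ. Then V_∞ is open if and only if closure(Gx) ∩ V_∞ = ∅ for all x ∈ X \ V_∞. -/

import Mathlib

open Filter Topology Set Pointwise Uniformity

namespace Reid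

/-- The group of self-homeomorphisms of a space, with `(f * g) x = f (g x)`. -/
instance {X : Type*} [TopologicalSpace X] : Group (X ≃ₜ X) where
  mul f g := g.trans f
  one := Homeomorph.refl X
  inv := Homeomorph.symm
  mul_assoc f g h := Homeomorph.ext fun _ => rfl
  one_mul f := Homeomorph.ext fun _ => rfl
  mul_one f := Homeomorph.ext fun _ => rfl
  inv_mul_cancel f := Homeomorph.ext f.symm_apply_apply

/-- The tautological action of the homeomorphism group on the space. -/
instance {X : Type*} [TopologicalSpace X] : MulAction (X ≃ₜ X) X where
  smul f x := f x
  one_smul _ := rfl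
  mul_smul _ _ _ := rfl

/-- A topological space is zero-dimensional if it has a base of clopen sets
(Hausdorffness is imposed separately as an instance). -/
def ZeroDimensional (X : Type*) [TopologicalSpace X] : Prop :=
  ∃ B : Set (Set X), TopologicalSpace.IsTopologicalBasis B ∧ ∀ U ∈ B, IsClopen U

section Translates

variable {X : Type*} [TopologicalSpace X]

theorem inv_mem_pow {S : Set (X ≃ₜ X)} (hSinv : S⁻¹ = S) {n : ℕ} {g : X ≃ₜ X}
    (hg : g ∈ S ^ n) : g⁻¹ ∈ S ^ n := by
  rw [← hSinv, inv_pow]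
  exact Set.inv_mem_inv.2 hg

theorem mem_image_iff_inv_apply_mem (g : X ≃ₜ X) (V : Set X) (x : X) :
    x ∈ g '' V ↔ g⁻¹ x ∈ V :=
  ⟨fun ⟨y, hy, hyx⟩ => hyx ▸ (g.symm_apply_apply y).symm ▸ hy,
    fun h => ⟨g⁻¹ x, h, g.apply_symm_apply x⟩⟩

theorem mem_iInter_image_iff {T : Set (X ≃ₜ X)} (hT : ∀ g ∈ T, g⁻¹ ∈ T) (V : Set X) (x : X) :
    x ∈ ⋂ g ∈ T, (g : X ≃ₜ X) '' V ↔ ∀ g ∈ T, g x ∈ V := by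
  simp only [mem_iInter, mem_image_iff_inv_apply_mem]
  exact ⟨fun h g hg => by simpa using h g⁻¹ (hT g hg), fun h g hg => h g⁻¹ (hT g hg)⟩

theorem exists_mem_pow_of_mem_closure {S : Set (X ≃ₜ X)} (hSinv : S⁻¹ = S) {g : X ≃ₜ X}
    (hg : g ∈ Subgroup.closure S) : ∃ n : ℕ, g ∈ S ^ n := by
  induction hg using Subgroup.closure_induction with
  | mem x hx => exact ⟨1, by simpa using hx⟩
  | one => exact ⟨0, by simp⟩
  | mul x y _ _ hx hy =>
    obtain ⟨m, hm⟩ := hx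
    obtain ⟨n, hn⟩ := hy
    exact ⟨m + n, pow_add S m n ▸ Set.mul_mem_mul hm hn⟩
  | inv x _ hx =>
    obtain ⟨n, hn⟩ := hx
    exact ⟨n, inv_mem_pow hSinv hn⟩

theorem pow_subset_closure (S : Set (X ≃ₜ X)) (n : ℕ) :
    S ^ n ⊆ (Subgroup.closure S : Set (X ≃ₜ X)) := by
  induction n with
  | zero => simp
  | succ n ih =>
    rw [pow_succ]
    rintro _ ⟨a, ha, b, hb, rfl⟩
    exact mul_mem (ih ha) (Subgroup.subset_closure hb)

end Translates

/-- Lemma 2.6(iii): with `1 ∈ S = S⁻¹`, `G = ⟨S⟩`, `V₀` compact open, `V_n = ⋂_{g ∈ Sⁿ} g(V₀)`,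
`V_∞ = ⋂_{g ∈ G} g(V₀)` and `P_n = (⋃_{g ∈ Sⁿ} g(V_n)) \ V₁`: if `P_n` is compact and `V_n` is
open for all sufficiently large `n`, then `V_∞` is open iff `closure (G x) ∩ V_∞ = ∅` for all
`x ∉ V_∞`. -/
theorem vinf_open_iff_orbit_closures_avoid {X : Type*} [TopologicalSpace X] [T2Space X]
    [LocallyCompactSpace X] (hzd : ZeroDimensional X)
    (S : Set (X ≃ₜ X)) (hS1 : 1 ∈ S) (hSinv : S⁻¹ = S)
    (G : Subgroup (X ≃ₜ X)) (hSgen : Subgroup.closure S = G)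
    (V0 : Set X) (hV0c : IsCompact V0) (hV0o : IsOpen V0)
    (Vn : ℕ → Set X) (hVn : ∀ n : ℕ, Vn n = ⋂ g ∈ S ^ n, (g : X ≃ₜ X) '' V0)
    (Vinf : Set X) (hVinf : Vinf = ⋂ g ∈ G, (g : X ≃ₜ X) '' V0)
    (Pn : ℕ → Set X) (hPn : ∀ n : ℕ, Pn n = (⋃ g ∈ S ^ n, (g : X ≃ₜ X) '' Vn n) \ Vn 1)
    (hyp : ∃ N : ℕ, ∀ n ≥ N, IsCompact (Pn n) ∧ IsOpen (Vn n)) :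
    IsOpen Vinf ↔ ∀ x ∉ Vinf, closure (MulAction.orbit G x) ∩ Vinf = ∅ := by
  subst hSgen
  have memV : ∀ n x, x ∈ Vn n ↔ ∀ g ∈ S ^ n, g x ∈ V0 := fun n x => by
    rw [hVn]
    exact mem_iInter_image_iff (fun _ => inv_mem_pow hSinv) V0 x
  have memInf : ∀ x, x ∈ Vinf ↔ ∀ g ∈ Subgroup.closure S, g x ∈ V0 := fun x => by
    rw [hVinf]
    exact mem_iInter_image_iff (T := (Subgroup.closure S : Set (X ≃ₜ X)))
      (fun _ => inv_mem) V0 x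
  have memP : ∀ n x, x ∈ Pn n ↔ (∃ g ∈ S ^ n, ∃ v ∈ Vn n, g v = x) ∧ x ∉ Vn 1 := fun n x => by
    simp [hPn]
  have infSub : ∀ n, Vinf ⊆ Vn n := fun n x hx =>
    (memV n x).2 fun g hg => (memInf x).1 hx g (pow_subset_closure S n hg)
  have infEq : ∀ x, (∀ n, x ∈ Vn n) → x ∈ Vinf := fun x hx => (memInf x).2 fun g hg => by
    obtain ⟨n, hn⟩ := exists_mem_pow_of_mem_closure hSinv hg
    exact (memV n x).1 (hx n) g hn
  have antiV : Antitone Vn := fun m n hmn x hx =>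
    (memV m x).2 fun g hg => (memV n x).1 hx g (Set.pow_subset_pow_right hS1 hmn hg)
  have antiP : Antitone Pn := antitone_nat_of_succ_le fun n x hx => by
    obtain ⟨⟨g, hg, v, hv, rfl⟩, hx1⟩ := (memP _ _).1 hx
    rw [pow_succ] at hg
    obtain ⟨h, hh, s, hs, rfl⟩ := hg
    refine (memP _ _).2 ⟨⟨h, hh, s v, (memV _ _).2 fun k hk => ?_, rfl⟩, hx1⟩
    exact (memV _ _).1 hv (k * s) (pow_succ S n ▸ Set.mul_mem_mul hk hs)
  have closedV : ∀ n, IsClosed (Vn n) := fun n => by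
    rw [hVn]
    exact isClosed_biInter fun g _ => (hV0c.image g.continuous).isClosed
  have compactV : ∀ n, IsCompact (Vn n) := fun n =>
    hV0c.of_isClosed_subset (closedV n) fun x hx =>
      (memV n x).1 hx 1 (Set.one_mem_pow hS1)
  constructor
  · intro hopen x hx
    rw [← disjoint_iff_inter_eq_empty]
    refine Disjoint.closure_left (Set.disjoint_left.2 ?_) hopen
    rintro _ ⟨g, rfl⟩ hgx
    refine hx ((memInf x).2 fun h hh => ?_)
    have key := (memInf _).1 hgx (h * (g : X ≃ₜ X)⁻¹) (mul_mem hh (inv_mem g.2))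
    have hgg : (h * (g : X ≃ₜ X)⁻¹) ((g : X ≃ₜ X) x) = h x :=
      congrArg h ((g : X ≃ₜ X).symm_apply_apply x)
    exact hgg ▸ key
  · intro horb
    obtain ⟨N, hN⟩ := hyp
    by_contra hnot
    have nonemptyP : ∀ n ≥ N, (Pn n).Nonempty := fun n hn => by
      obtain ⟨v, hv, hvinf⟩ : ∃ v ∈ Vn n, v ∉ Vinf := by
        by_contra! hsub
        exact hnot (Subset.antisymm (infSub n) hsub ▸ (hN n hn).2)
      have hex : ∃ m, v ∉ Vn (n + m) := by
        by_contra! hall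
        exact hvinf (infEq v fun m => antiV (Nat.le_add_left m n) (hall m))
      obtain ⟨k, hk, hk'⟩ : ∃ k, v ∈ Vn (n + k) ∧ v ∉ Vn (n + k + 1) := by
        by_contra! hstep
        obtain ⟨m, hm⟩ := hex
        exact hm (Nat.rec hv (fun k hk => hstep k hk) m)
      rw [memV] at hk'
      push Not at hk'
      obtain ⟨g, hg, hgv⟩ := hk'
      rw [pow_succ'] at hg
      obtain ⟨s, hs, h, hh, rfl⟩ := hg
      exact ⟨h v, antiP (Nat.le_add_right n k) ((memP _ _).2
        ⟨⟨h, hh, v, hk, rfl⟩, fun h1 => hgv ((memV _ _).1 h1 s (by simpa using hs))⟩)⟩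
    obtain ⟨x, hx⟩ := IsCompact.nonempty_iInter_of_sequence_nonempty_isCompact_isClosed
      (fun n => Pn (N + n)) (fun n => antiP (Nat.le_succ _))
      (fun n => nonemptyP _ (Nat.le_add_right N n)) (hN _ le_rfl).1
      (fun n => (hN _ (Nat.le_add_right N n)).1.isClosed)
    rw [mem_iInter] at hx
    have hxinf : x ∉ Vinf := fun h => ((memP _ _).1 (hx 0)).2 (infSub 1 h)
    obtain ⟨y, hy⟩ := IsCompact.nonempty_iInter_of_sequence_nonempty_isCompact_isClosed
      (fun n => closure (MulAction.orbit (Subgroup.closure S) x) ∩ Vn n)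
      (fun n => inter_subset_inter_right _ (antiV (Nat.le_succ n)))
      (fun n => by
        obtain ⟨⟨g, hg, v, hv, hgv⟩, -⟩ := (memP _ _).1 (hx n)
        refine ⟨v, subset_closure ⟨⟨g⁻¹, inv_mem (pow_subset_closure S _ hg)⟩, ?_⟩,
          antiV (Nat.le_add_left n N) hv⟩
        exact hgv ▸ g.symm_apply_apply v)
      ((compactV 0).inter_left isClosed_closure)
      (fun n => isClosed_closure.inter (closedV n))
    rw [mem_iInter] at hy
    exact (horb x hxinf).subset ⟨(hy 0).1, infEq y fun n => (hy n).2⟩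

end Reid
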